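/- arXiv:2405.11969 — 7 statements merged into one kernel-verified Lean document; each statement's English description precedes it below -/
import Mathlib

section
/- Two-sided Riesz convolution bound: Let d ≥ 1 be an integer and α ∈ (0, d/2). Then there exist constants 0 < N₁ ≤ N₂, depending only on d and α, such that for every x ∈ ℝ^d with x ≠ 0, N₁ |x|^{2α−d} ≤ ∫_{ℝ^d} |y|^{α−d} |x−y|^{α−d} dy ≤ N₂ |x|^{2α−d}. -/
open MeasureTheory Set

/-- The radial profile `t ^ γ` near the origin, `t ^ (2 * γ)` at infinity. -/
noncomputable def rieszProfile (γ t : ℝ) : ℝ := if t < 1 then t ^ γ else t ^ (2 * γ)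

lemma rieszProfile_nonneg (γ : ℝ) {t : ℝ} (ht : 0 ≤ t) : 0 ≤ rieszProfile γ t := by
  unfold rieszProfile
  split_ifs <;> positivity

lemma rpow_mul_rpow_le_rieszProfile {γ u v : ℝ} (hγ : γ < 0) (hu : 0 ≤ u) (huv : u ≤ v)
    (h : 2 ≤ u + v) : u ^ γ * v ^ γ ≤ rieszProfile γ u := by
  unfold rieszProfile
  split_ifs with h1
  · exact mul_le_of_le_one_right (Real.rpow_nonneg hu _)
      (Real.rpow_le_one_of_one_le_of_nonpos (by linarith) hγ.le)
  · have hu0 : 0 < u := by linarith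
    rw [two_mul, Real.rpow_add hu0]
    gcongr ?_ * ?_
    exact Real.rpow_le_rpow_of_nonpos hu0 huv hγ.le

lemma rpow_mul_rpow_le_rieszProfile_add {γ u v : ℝ} (hγ : γ < 0) (hu : 0 ≤ u) (hv : 0 ≤ v)
    (h : 2 ≤ u + v) : u ^ γ * v ^ γ ≤ rieszProfile γ u + rieszProfile γ v := by
  have gu := rieszProfile_nonneg γ hu
  have gv := rieszProfile_nonneg γ hv
  rcases le_total u v with huv | huv
  · linarith [rpow_mul_rpow_le_rieszProfile hγ hu huv h]
  · linarith [rpow_mul_rpow_le_rieszProfile hγ hv huv (by linarith), mul_comm (u ^ γ) (v ^ γ)]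

section

variable {E : Type*} [NormedAddCommGroup E] [NormedSpace ℝ E] [FiniteDimensional ℝ E]
  [Nontrivial E] [MeasurableSpace E] [BorelSpace E] (μ : Measure E) [μ.IsAddHaarMeasure]

lemma integrable_rieszProfile_norm {γ : ℝ} (h1 : -(Module.finrank ℝ E : ℝ) < γ)
    (h2 : 2 * γ < -(Module.finrank ℝ E : ℝ)) :
    Integrable (fun y : E ↦ rieszProfile γ ‖y‖) μ := by
  have hd : 1 ≤ Module.finrank ℝ E := Module.finrank_pos
  have key (s t : ℝ) (ht : 0 < t) :
      t ^ (Module.finrank ℝ E - 1) * t ^ s = t ^ ((Module.finrank ℝ E : ℝ) - 1 + s) := by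
    rw [Real.rpow_add ht, ← Nat.cast_pred hd, Real.rpow_natCast]
  rw [integrable_fun_norm_addHaar μ (f := rieszProfile γ),
    ← Ioo_union_Ici_eq_Ioi (zero_lt_one (α := ℝ)), integrableOn_union]
  constructor
  · refine ((intervalIntegral.integrableOn_Ioo_rpow_iff
      (s := (Module.finrank ℝ E : ℝ) - 1 + γ) zero_lt_one).2 (by linarith)).congr_fun
      (fun t ht ↦ ?_) measurableSet_Ioo
    simp only [rieszProfile, if_pos ht.2, smul_eq_mul, key γ t ht.1]
  · rw [integrableOn_Ici_iff_integrableOn_Ioi]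
    refine (integrableOn_Ioi_rpow_of_lt (a := (Module.finrank ℝ E : ℝ) - 1 + 2 * γ)
      (by linarith) zero_lt_one).congr_fun (fun t (ht : 1 < t) ↦ ?_) measurableSet_Ioi
    simp only [rieszProfile, if_neg ht.not_gt, smul_eq_mul, key (2 * γ) t (by linarith)]

lemma lintegral_riesz_le {γ : ℝ} (h1 : -(Module.finrank ℝ E : ℝ) < γ)
    (h2 : 2 * γ < -(Module.finrank ℝ E : ℝ)) {x : E} (hx : x ≠ 0) :
    ∫⁻ y, ENNReal.ofReal (‖y‖ ^ γ * ‖x - y‖ ^ γ) ∂μ ≤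
      ENNReal.ofReal ((‖x‖ / 2) ^ (2 * γ + Module.finrank ℝ E) *
        (2 * ∫ y, rieszProfile γ ‖y‖ ∂μ)) := by
  set r : ℝ := ‖x‖ / 2 with hr_def
  have hr : 0 < r := by positivity
  have hγ : γ < 0 := by
    have : (0 : ℝ) ≤ Module.finrank ℝ E := Nat.cast_nonneg _
    linarith
  set G : E → ℝ := fun y ↦ rieszProfile γ ‖r⁻¹ • y‖ with hG
  have hGi : Integrable G μ :=
    (integrable_rieszProfile_norm μ h1 h2).comp_smul (inv_ne_zero hr.ne')
  have hGint : ∫ y, G y ∂μ = r ^ Module.finrank ℝ E * ∫ y, rieszProfile γ ‖y‖ ∂μ := by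
    rw [hG, Measure.integral_comp_inv_smul_of_nonneg μ (fun y : E ↦ rieszProfile γ ‖y‖) hr.le,
      smul_eq_mul]
  have hG0 (y : E) : 0 ≤ G y := rieszProfile_nonneg γ (norm_nonneg _)
  have hle (y : E) : ‖y‖ ^ γ * ‖x - y‖ ^ γ ≤ r ^ (2 * γ) * (G y + G (x - y)) := by
    have hn (z : E) : ‖z‖ = r * ‖r⁻¹ • z‖ := by
      rw [norm_smul, norm_inv, Real.norm_of_nonneg hr.le, mul_inv_cancel_left₀ hr.ne']
    have hsum : 2 ≤ ‖r⁻¹ • y‖ + ‖r⁻¹ • (x - y)‖ := by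
      have : ‖x‖ ≤ ‖y‖ + ‖x - y‖ := by simpa using norm_add_le y (x - y)
      rw [hn y, hn (x - y), ← mul_add] at this
      refine le_of_mul_le_mul_left (a := r) ?_ hr
      linarith
    have := rpow_mul_rpow_le_rieszProfile_add hγ (norm_nonneg _) (norm_nonneg _) hsum
    rw [hn y, hn (x - y), Real.mul_rpow hr.le (norm_nonneg _),
      Real.mul_rpow hr.le (norm_nonneg _), mul_mul_mul_comm, ← Real.rpow_add hr, ← two_mul]
    gcongr
  have hint : Integrable (fun y ↦ r ^ (2 * γ) * (G y + G (x - y))) μ :=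
    (hGi.add (hGi.comp_sub_left x)).const_mul _
  refine (lintegral_mono fun y ↦ ENNReal.ofReal_le_ofReal (hle y)).trans_eq ?_
  rw [← ofReal_integral_eq_lintegral_ofReal hint (.of_forall fun y ↦
      mul_nonneg (by positivity) (add_nonneg (hG0 _) (hG0 _))), integral_const_mul,
    integral_add hGi (hGi.comp_sub_left x), integral_sub_left_eq_self G μ x, hGint,
    Real.rpow_add hr, Real.rpow_natCast]
  ring_nf

lemma le_lintegral_riesz {γ : ℝ} (hγ : γ ≤ 0) {x : E} (hx : x ≠ 0) :
    ENNReal.ofReal (‖x‖ ^ (2 * γ) * ((‖x‖ / 2) ^ Module.finrank ℝ E *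
        μ.real (Metric.ball 0 1))) ≤
      ∫⁻ y, ENNReal.ofReal (‖y‖ ^ γ * ‖x - y‖ ^ γ) ∂μ := by
  have hx0 : 0 < ‖x‖ := norm_pos_iff.2 hx
  set z : E := (2⁻¹ : ℝ) • x with hz
  have hxz : x - z = z := by rw [hz]; module
  have hzn : ‖z‖ = ‖x‖ / 2 := by
    rw [hz, norm_smul]; norm_num; ring
  have bound {w : E} (hw : ‖w - z‖ < ‖x‖ / 2) : ‖x‖ ^ γ ≤ ‖w‖ ^ γ := by
    have h1 : 0 < ‖w‖ := by
      linarith [norm_sub_norm_le z w, norm_sub_rev z w]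
    exact Real.rpow_le_rpow_of_nonpos h1 (by linarith [norm_sub_norm_le w z]) hγ
  calc
    _ = ∫⁻ _ in Metric.ball z (‖x‖ / 2), ENNReal.ofReal (‖x‖ ^ (2 * γ)) ∂μ := by
      rw [setLIntegral_const, Measure.addHaar_ball μ z (by positivity),
        ENNReal.ofReal_mul (by positivity), ENNReal.ofReal_mul (by positivity),
        ofReal_measureReal]
    _ ≤ ∫⁻ y in Metric.ball z (‖x‖ / 2), ENNReal.ofReal (‖y‖ ^ γ * ‖x - y‖ ^ γ) ∂μ := by
      refine setLIntegral_mono' Metric.isOpen_ball.measurableSet fun y hy ↦ ?_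
      rw [mem_ball_iff_norm] at hy
      have hy' : ‖(x - y) - z‖ < ‖x‖ / 2 := by
        rwa [sub_right_comm, hxz, norm_sub_rev]
      refine ENNReal.ofReal_le_ofReal ?_
      rw [two_mul, Real.rpow_add hx0]
      exact mul_le_mul (bound hy) (bound hy') (by positivity) (by positivity)
    _ ≤ _ := setLIntegral_le_lintegral _ _

end

/-- **Two-sided Riesz convolution bound.** -/
theorem riesz_convolution_two_sided (d : ℕ) (hd : 1 ≤ d) (α : ℝ)
    (hα0 : 0 < α) (hα : α < (d : ℝ) / 2) :
    ∃ N₁ N₂ : ℝ, 0 < N₁ ∧ N₁ ≤ N₂ ∧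
      ∀ x : EuclideanSpace ℝ (Fin d), x ≠ 0 →
        ENNReal.ofReal (N₁ * ‖x‖ ^ (2 * α - d)) ≤
            (∫⁻ y, ENNReal.ofReal (‖y‖ ^ (α - (d : ℝ)) * ‖x - y‖ ^ (α - (d : ℝ)))) ∧
          (∫⁻ y, ENNReal.ofReal (‖y‖ ^ (α - (d : ℝ)) * ‖x - y‖ ^ (α - (d : ℝ)))) ≤
            ENNReal.ofReal (N₂ * ‖x‖ ^ (2 * α - d)) := by
  have : Nonempty (Fin d) := ⟨⟨0, hd⟩⟩
  have hd' : (1 : ℝ) ≤ d := by exact_mod_cast hd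
  have hfin : Module.finrank ℝ (EuclideanSpace ℝ (Fin d)) = d := by simp
  set c : ℝ := volume.real (Metric.ball (0 : EuclideanSpace ℝ (Fin d)) 1)
  set I : ℝ := ∫ y : EuclideanSpace ℝ (Fin d), rieszProfile (α - d) ‖y‖
  have hc : 0 < c := ENNReal.toReal_pos (Metric.measure_ball_pos _ _ one_pos).ne'
    measure_ball_lt_top.ne
  refine ⟨c / 2 ^ d, max (c / 2 ^ d) (2 * I / 2 ^ (2 * α - d)), by positivity,
    le_max_left _ _, fun x hx ↦ ?_⟩
  have hx0 : 0 < ‖x‖ := norm_pos_iff.2 hx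
  have hexp : 2 * (α - d) + d = 2 * α - d := by ring
  constructor
  · refine le_of_eq_of_le ?_ (le_lintegral_riesz volume (by linarith) hx)
    rw [hfin, ← hexp, Real.rpow_add hx0, Real.rpow_natCast, div_pow]
    congr 1
    ring
  · refine (lintegral_riesz_le volume (by rw [hfin]; linarith) (by rw [hfin]; linarith)
      hx).trans (ENNReal.ofReal_le_ofReal ?_)
    rw [hfin, hexp, Real.div_rpow hx0.le zero_le_two]
    calc
      _ = 2 * I / 2 ^ (2 * α - d) * ‖x‖ ^ (2 * α - d) := by ring
      _ ≤ _ := by gcongr; exact le_max_right _ _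
end

section
/- Convolution-power interpolation inequality: Let d ≥ 1, let f : ℝ^d → [0,∞) be measurable with ∫ f^{r₁} dy < ∞ and ∫ f^{r₂} dy < ∞, where 1 ≤ r₁ ≤ r₂ < ∞. Then for every x ∈ ℝ^d, ∫_{ℝ^d} f(x−y)^{r₁} f(y)^{r₁} dy ≤ ( ∫_{ℝ^d} f^{r₁} dy )^{1 − r₁/r₂} · ( ∫_{ℝ^d} f^{r₂} dy )^{(r₁/r₂)(1 − r₁/r₂)} · ( ∫_{ℝ^d} f(x−y)^{r₂} f(y)^{r₂} dy )^{(r₁/r₂)²}. -/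
open MeasureTheory Set

/-- Interpolation of `∫ aᵗ bᵗ` between `∫ aᵗ`, `∫ b` and `∫ a b`, by Hölder's inequality. -/
theorem lintegral_rpow_mul_rpow_le_interpolation {α : Type*} [MeasurableSpace α] {μ : Measure α}
    {a b : α → ENNReal} (ha : AEMeasurable a μ) (hb : AEMeasurable b μ)
    {t : ℝ} (ht0 : 0 ≤ t) (ht1 : t ≤ 1) :
    ∫⁻ y, a y ^ t * b y ^ t ∂μ ≤
      (∫⁻ y, a y ^ t ∂μ) ^ (1 - t) * (∫⁻ y, b y ∂μ) ^ (t * (1 - t)) *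
        (∫⁻ y, a y * b y ∂μ) ^ (t ^ (2 : ℕ)) := by
  have hs : 0 ≤ 1 - t := sub_nonneg.2 ht1
  have split (c : ENNReal) : c = c ^ (1 - t) * c ^ t := by
    rw [← ENNReal.rpow_add_of_nonneg _ _ hs ht0, sub_add_cancel, ENNReal.rpow_one]
  calc ∫⁻ y, a y ^ t * b y ^ t ∂μ
      = ∫⁻ y, (a y ^ t) ^ (1 - t) * (a y ^ t * b y) ^ t ∂μ := by
        refine lintegral_congr fun y => ?_
        rw [ENNReal.mul_rpow_of_nonneg _ _ ht0, ← mul_assoc, ← split]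
    _ ≤ (∫⁻ y, a y ^ t ∂μ) ^ (1 - t) * (∫⁻ y, a y ^ t * b y ∂μ) ^ t :=
        ENNReal.lintegral_mul_norm_pow_le (ha.pow_const t) ((ha.pow_const t).mul hb) hs ht0
          (sub_add_cancel 1 t)
    _ = (∫⁻ y, a y ^ t ∂μ) ^ (1 - t) * (∫⁻ y, b y ^ (1 - t) * (a y * b y) ^ t ∂μ) ^ t := by
        congr 2
        refine lintegral_congr fun y => ?_
        rw [ENNReal.mul_rpow_of_nonneg _ _ ht0, mul_left_comm, ← split]
    _ ≤ (∫⁻ y, a y ^ t ∂μ) ^ (1 - t) *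
          ((∫⁻ y, b y ∂μ) ^ (1 - t) * (∫⁻ y, a y * b y ∂μ) ^ t) ^ t := by
        gcongr
        exact ENNReal.lintegral_mul_norm_pow_le hb (ha.mul hb) hs ht0 (sub_add_cancel 1 t)
    _ = _ := by
        rw [ENNReal.mul_rpow_of_nonneg _ _ ht0, ← ENNReal.rpow_mul, ← ENNReal.rpow_mul,
          mul_comm (1 - t) t, ← pow_two, mul_assoc]

/-- **Convolution-power interpolation inequality.** -/
theorem convolution_power_interpolation (d : ℕ) (hd : 1 ≤ d)
    (f : EuclideanSpace ℝ (Fin d) → ℝ) (hf : Measurable f) (hf0 : ∀ y, 0 ≤ f y)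
    (r₁ r₂ : ℝ) (hr₁ : 1 ≤ r₁) (hr₁₂ : r₁ ≤ r₂)
    (hfin₁ : (∫⁻ y, ENNReal.ofReal (f y ^ r₁)) < ⊤)
    (hfin₂ : (∫⁻ y, ENNReal.ofReal (f y ^ r₂)) < ⊤) :
    ∀ x : EuclideanSpace ℝ (Fin d),
      (∫⁻ y, ENNReal.ofReal (f (x - y) ^ r₁ * f y ^ r₁)) ≤
        (∫⁻ y, ENNReal.ofReal (f y ^ r₁)) ^ (1 - r₁ / r₂) *
          (∫⁻ y, ENNReal.ofReal (f y ^ r₂)) ^ ((r₁ / r₂) * (1 - r₁ / r₂)) *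
          (∫⁻ y, ENNReal.ofReal (f (x - y) ^ r₂ * f y ^ r₂)) ^ ((r₁ / r₂) ^ (2 : ℕ)) := by
  intro x
  have hr₂ : 0 < r₂ := by linarith
  have ht0 : 0 ≤ r₁ / r₂ := by positivity
  have ht1 : r₁ / r₂ ≤ 1 := (div_le_one hr₂).2 hr₁₂
  have hpow (z : EuclideanSpace ℝ (Fin d)) :
      ENNReal.ofReal (f z ^ r₁) = ENNReal.ofReal (f z ^ r₂) ^ (r₁ / r₂) := by
    rw [ENNReal.ofReal_rpow_of_nonneg (Real.rpow_nonneg (hf0 z) _) ht0, ← Real.rpow_mul (hf0 z),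
      mul_div_cancel₀ _ hr₂.ne']
  have hmul (r : ℝ) (y : EuclideanSpace ℝ (Fin d)) :
      ENNReal.ofReal (f (x - y) ^ r * f y ^ r) =
        ENNReal.ofReal (f (x - y) ^ r) * ENNReal.ofReal (f y ^ r) :=
    ENNReal.ofReal_mul (Real.rpow_nonneg (hf0 _) _)
  have hb : Measurable fun y => ENNReal.ofReal (f y ^ r₂) := (hf.pow_const r₂).ennreal_ofReal
  have ha : Measurable fun y => ENNReal.ofReal (f (x - y) ^ r₂) :=
    hb.comp (measurable_const.sub measurable_id)
  rw [← lintegral_sub_left_eq_self (fun y => ENNReal.ofReal (f y ^ r₁)) x]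
  simp only [hmul, hpow]
  exact lintegral_rpow_mul_rpow_le_interpolation ha.aemeasurable hb.aemeasurable ht0 ht1
end

section
/- Marchaud-type inequality: Let T > 0, let L ≥ 1 be an integer, let θ ∈ (0,1), and let f : [0,T] → ℝ be continuous. Then there exist constants N₁ = N₁(θ, L, T) and N₂ = N₂(θ, L) such that sup_{t,s ∈ [0,T], t ≠ s} |f(t) − f(s)| / |t−s|^θ ≤ N₁ · sup_{t ∈ [0,T]} |f(t)| + N₂ · [f]_{C^θ_L([0,T])}, with the convention that the inequality is trivial if the right-hand side is infinite. -/
open MeasureTheory Set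
open scoped ENNReal

/-- The `L`-th order forward difference of `f` with step `τ`, evaluated at `s`. -/
noncomputable def diffL (L : ℕ) (τ : ℝ) (f : ℝ → ℝ) (s : ℝ) : ℝ :=
  ∑ k ∈ Finset.range (L + 1), (-1 : ℝ) ^ (L - k) * (L.choose k : ℝ) * f (s + (k : ℝ) * τ)

/-- The `L`-th modulus of smoothness of `f` on `[0,T]`, valued in `[0,∞]`. -/
noncomputable def modulusL (T : ℝ) (L : ℕ) (f : ℝ → ℝ) (t : ℝ) : ℝ≥0∞ :=
  ⨆ (τ : ℝ) (_ : 0 < |τ| ∧ |τ| ≤ t) (s : ℝ)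
    (_ : s ∈ Set.Icc 0 T ∧ s + (L : ℝ) * τ ∈ Set.Icc 0 T),
    ENNReal.ofReal |diffL L τ f s|

/-- The seminorm `[f]_{C^θ_L([0,T])}`, valued in `[0,∞]`. -/
noncomputable def holderSemiL (T : ℝ) (L : ℕ) (θ : ℝ) (f : ℝ → ℝ) : ℝ≥0∞ :=
  ⨆ (t : ℝ) (_ : 0 < t), modulusL T L f t / ENNReal.ofReal (t ^ θ)

theorem diffL_eq_fwdDiff_iter (L : ℕ) (τ : ℝ) (f : ℝ → ℝ) (s : ℝ) :
    diffL L τ f s = (fwdDiff τ)^[L] f s := by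
  rw [fwdDiff_iter_eq_sum_shift, diffL]
  refine Finset.sum_congr rfl fun k _ => ?_
  simp [zsmul_eq_mul, nsmul_eq_mul]

theorem diffL_succ (L : ℕ) (τ : ℝ) (f : ℝ → ℝ) (s : ℝ) :
    diffL (L + 1) τ f s = diffL L τ f (s + τ) - diffL L τ f s := by
  simp only [diffL_eq_fwdDiff_iter, Function.iterate_succ_apply', fwdDiff]

theorem diffL_add_mul_sub (L j : ℕ) (τ : ℝ) (f : ℝ → ℝ) (s : ℝ) :
    diffL L τ f (s + j * τ) - diffL L τ f s =
      ∑ i ∈ Finset.range j, diffL (L + 1) τ f (s + i * τ) := by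
  have h := Finset.sum_range_sub (fun i : ℕ => diffL L τ f (s + i * τ)) j
  simp only [Nat.cast_zero, zero_mul, add_zero] at h
  rw [← h]
  refine Finset.sum_congr rfl fun i _ => ?_
  rw [diffL_succ]
  push_cast
  ring_nf

theorem diffL_two_mul (L : ℕ) (τ : ℝ) (f : ℝ → ℝ) (s : ℝ) :
    diffL L (2 * τ) f s =
      ∑ j ∈ Finset.range (L + 1), (L.choose j : ℝ) * diffL L τ f (s + j * τ) := by
  have hmul : fwdDiff_aux.fwdDiffₗ ℝ ℝ (2 * τ) =
      (fwdDiff_aux.shiftₗ ℝ ℝ τ + 1) * fwdDiff_aux.fwdDiffₗ ℝ ℝ τ := by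
    ext g x
    simp [fwdDiff_aux.shiftₗ, fwdDiff, two_mul, add_assoc]
  have hcomm : Commute (fwdDiff_aux.shiftₗ ℝ ℝ τ + 1) (fwdDiff_aux.fwdDiffₗ ℝ ℝ τ) := by
    rw [fwdDiff_aux.shiftₗ]
    exact ((Commute.refl _).add_left (Commute.one_left _)).add_left (Commute.one_left _)
  have key : (fwdDiff_aux.fwdDiffₗ ℝ ℝ (2 * τ) ^ L) f s =
      (((fwdDiff_aux.shiftₗ ℝ ℝ τ + 1) ^ L) ((fwdDiff_aux.fwdDiffₗ ℝ ℝ τ ^ L) f)) s := by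
    rw [hmul, hcomm.mul_pow]
    rfl
  simp only [diffL_eq_fwdDiff_iter, ← fwdDiff_aux.coe_fwdDiffₗ_pow]
  rw [key, (Commute.one_right _).add_pow]
  simp only [one_pow, mul_one, LinearMap.sum_apply, Finset.sum_apply]
  refine Finset.sum_congr rfl fun j _ => ?_
  rw [← nsmul_eq_mul', LinearMap.smul_apply, Pi.smul_apply, fwdDiff_aux.shiftₗ_pow_apply]
  simp [nsmul_eq_mul]

theorem diffL_neg (L : ℕ) (τ : ℝ) (f : ℝ → ℝ) (s : ℝ) :
    diffL L (-τ) f (s + L * τ) = (-1) ^ L * diffL L τ f s := by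
  rw [diffL, diffL, ← Finset.sum_range_reflect, Finset.mul_sum]
  refine Finset.sum_congr rfl fun k hk => ?_
  obtain ⟨m, rfl⟩ := Nat.exists_eq_add_of_le (Nat.lt_succ_iff.mp (Finset.mem_range.mp hk))
  have h₁ : k + m + 1 - 1 - k = m := by omega
  have h₂ : k + m - m = k := by omega
  have h₃ : k + m - k = m := by omega
  have h₄ : s + ((k + m : ℕ) : ℝ) * τ + (m : ℝ) * -τ = s + k * τ := by push_cast; ring
  have h₅ : ((-1 : ℝ) ^ m) * (-1) ^ m = 1 := by rw [← mul_pow]; simp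
  rw [h₁, h₂, h₃, h₄, Nat.choose_symm_add, pow_add]
  linear_combination -((-1) ^ k * ((k + m).choose m : ℝ) * f (s + k * τ)) * h₅

theorem add_mul_mem_Icc_of_le {T s τ a b : ℝ} (hs : s ∈ Icc 0 T) (hsa : s + a * τ ∈ Icc 0 T)
    (hb : 0 ≤ b) (hba : b ≤ a) : s + b * τ ∈ Icc 0 T := by
  obtain ⟨h₁, h₂⟩ := hs
  obtain ⟨h₃, h₄⟩ := hsa
  rcases le_total 0 τ with h | h
  · have := mul_le_mul_of_nonneg_right hba h
    have := mul_nonneg hb h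
    constructor <;> linarith
  · have := mul_le_mul_of_nonpos_right hba h
    have := mul_nonpos_of_nonneg_of_nonpos hb h
    constructor <;> linarith

theorem abs_diffL_le {L : ℕ} {T M τ s : ℝ} {f : ℝ → ℝ} (hM : ∀ t ∈ Icc 0 T, |f t| ≤ M)
    (hs : s ∈ Icc 0 T) (hs' : s + L * τ ∈ Icc 0 T) : |diffL L τ f s| ≤ 2 ^ L * M := by
  calc |diffL L τ f s|
      ≤ ∑ k ∈ Finset.range (L + 1), (L.choose k : ℝ) * M := by
        refine (Finset.abs_sum_le_sum_abs _ _).trans (Finset.sum_le_sum fun k hk => ?_)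
        rw [abs_mul, abs_mul, abs_pow, abs_neg, abs_one, one_pow, one_mul, Nat.abs_cast]
        gcongr
        refine hM _ (add_mul_mem_Icc_of_le hs hs' k.cast_nonneg ?_)
        exact_mod_cast Nat.lt_succ_iff.mp (Finset.mem_range.mp hk)
    _ = 2 ^ L * M := by
        rw [← Finset.sum_mul]
        exact_mod_cast congrArg (fun n : ℕ => (n : ℝ) * M) (Nat.sum_range_choose L)

/-- Comparison of the `L`-th differences with steps `τ` and `2 * τ`. -/
theorem two_pow_mul_abs_diffL_le {L : ℕ} {T A τ s : ℝ} {f : ℝ → ℝ}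
    (hA : ∀ x ∈ Icc 0 T, x + ((L + 1 : ℕ) : ℝ) * τ ∈ Icc 0 T → |diffL (L + 1) τ f x| ≤ A)
    (hs : s ∈ Icc 0 T) (hs' : s + (2 * L : ℝ) * τ ∈ Icc 0 T) :
    2 ^ L * |diffL L τ f s| ≤ |diffL L (2 * τ) f s| + 2 ^ L * (L * A) := by
  have hterm : ∀ j ∈ Finset.range (L + 1),
      |diffL L τ f (s + j * τ) - diffL L τ f s| ≤ L * A := by
    intro j hj
    have hjL : j ≤ L := Nat.lt_succ_iff.mp (Finset.mem_range.mp hj)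
    have hi : ∀ i < L, |diffL (L + 1) τ f (s + i * τ)| ≤ A := by
      intro i hi
      have hiL : (i : ℝ) + 1 ≤ L := by exact_mod_cast hi
      have hi0 : (0 : ℝ) ≤ i := i.cast_nonneg
      refine hA _ (add_mul_mem_Icc_of_le hs hs' hi0 (by linarith)) ?_
      have := add_mul_mem_Icc_of_le (b := i + (L + 1)) hs hs' (by linarith) (by linarith)
      convert this using 1
      push_cast
      ring
    rw [diffL_add_mul_sub]
    refine (Finset.abs_sum_le_sum_abs _ _).trans ?_
    calc ∑ i ∈ Finset.range j, |diffL (L + 1) τ f (s + i * τ)|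
        ≤ ∑ i ∈ Finset.range L, |diffL (L + 1) τ f (s + i * τ)| :=
          Finset.sum_le_sum_of_subset_of_nonneg (Finset.range_mono hjL)
            fun _ _ _ => abs_nonneg _
      _ ≤ L * A := by
          refine (Finset.sum_le_card_nsmul _ _ A fun i h => hi i (Finset.mem_range.mp h)).trans ?_
          simp
  have hsum : ∑ j ∈ Finset.range (L + 1), (L.choose j : ℝ) = 2 ^ L := by
    exact_mod_cast Nat.sum_range_choose L
  have hdiff : diffL L (2 * τ) f s - 2 ^ L * diffL L τ f s =
      ∑ j ∈ Finset.range (L + 1),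
        (L.choose j : ℝ) * (diffL L τ f (s + j * τ) - diffL L τ f s) := by
    simp only [mul_sub, Finset.sum_sub_distrib, ← Finset.sum_mul, hsum, diffL_two_mul L τ f s]
  have hle : |diffL L (2 * τ) f s - 2 ^ L * diffL L τ f s| ≤ 2 ^ L * (L * A) := by
    rw [hdiff, ← hsum, Finset.sum_mul]
    refine (Finset.abs_sum_le_sum_abs _ _).trans (Finset.sum_le_sum fun j hj => ?_)
    rw [abs_mul, Nat.abs_cast]
    exact mul_le_mul_of_nonneg_left (hterm j hj) (Nat.cast_nonneg _)
  have habs : |2 ^ L * diffL L τ f s| = 2 ^ L * |diffL L τ f s| := by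
    rw [abs_mul, abs_of_pos (by positivity)]
  have := abs_sub_abs_le_abs_sub (2 ^ L * diffL L τ f s) (diffL L (2 * τ) f s)
  rw [abs_sub_comm] at this
  linarith

theorem one_sub_two_rpow_div_two_pos {θ : ℝ} (hθ1 : θ < 1) : 0 < 1 - (2 : ℝ) ^ θ / 2 := by
  have : (2 : ℝ) ^ θ < 2 ^ (1 : ℝ) := Real.rpow_lt_rpow_of_exponent_lt one_lt_two hθ1
  rw [Real.rpow_one] at this
  linarith

/-- A Hölder bound on the differences of order `L + 1` yields one on those of order `L`. -/
theorem abs_diffL_le_of_succ {L : ℕ} (hL : 1 ≤ L) {θ T M K : ℝ} (hθ0 : 0 < θ) (hθ1 : θ < 1)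
    (hT : 0 < T) (hM0 : 0 ≤ M) (hK0 : 0 ≤ K) {f : ℝ → ℝ} (hM : ∀ t ∈ Icc 0 T, |f t| ≤ M)
    (hK : ∀ τ s : ℝ, τ ≠ 0 → s ∈ Icc 0 T → s + ((L + 1 : ℕ) : ℝ) * τ ∈ Icc 0 T →
      |diffL (L + 1) τ f s| ≤ K * |τ| ^ θ)
    {τ s : ℝ} (hτ : τ ≠ 0) (hs : s ∈ Icc 0 T) (hs' : s + L * τ ∈ Icc 0 T) :
    |diffL L τ f s| ≤
      (2 ^ L * (3 * L / T) ^ θ * M + L / (1 - 2 ^ θ / 2) * K) * |τ| ^ θ := by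
  have hLpos : (0 : ℝ) < L := by exact_mod_cast hL
  have hr := one_sub_two_rpow_div_two_pos hθ1
  set B := 2 ^ L * (3 * L / T) ^ θ * M + L / (1 - 2 ^ θ / 2) * K with hB
  have hMB : 2 ^ L * (3 * L / T) ^ θ * M ≤ B := by
    rw [hB]
    exact le_add_of_nonneg_right (by positivity)
  have hKB : L * K ≤ (1 - 2 ^ θ / 2) * B := by
    have h₁ : (1 - (2 : ℝ) ^ θ / 2) * (L / (1 - 2 ^ θ / 2) * K) = L * K := by
      rw [← mul_assoc, mul_div_cancel₀ _ hr.ne']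
    have h₂ : 0 ≤ (1 - (2 : ℝ) ^ θ / 2) * (2 ^ L * (3 * L / T) ^ θ * M) := by positivity
    rw [hB, mul_add, h₁]
    linarith
  have hB0 : 0 ≤ B := by positivity
  have hlarge : ∀ τ s : ℝ, T ≤ 3 * L * |τ| → s ∈ Icc 0 T → s + L * τ ∈ Icc 0 T →
      |diffL L τ f s| ≤ B * |τ| ^ θ := by
    intro τ s hτ hs hs'
    have h₁ : 1 ≤ (3 * L / T) ^ θ * |τ| ^ θ := by
      rw [← Real.mul_rpow (by positivity) (abs_nonneg _)]
      refine Real.one_le_rpow ?_ hθ0.le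
      rw [div_mul_eq_mul_div, one_le_div hT]
      exact hτ
    calc |diffL L τ f s| ≤ 2 ^ L * M := abs_diffL_le hM hs hs'
      _ ≤ 2 ^ L * M * ((3 * L / T) ^ θ * |τ| ^ θ) := le_mul_of_one_le_right (by positivity) h₁
      _ = 2 ^ L * (3 * L / T) ^ θ * M * |τ| ^ θ := by ring
      _ ≤ B * |τ| ^ θ := by gcongr
  have hdouble : ∀ τ s : ℝ, τ ≠ 0 → s ∈ Icc 0 T → s + (2 * L : ℝ) * τ ∈ Icc 0 T →
      |diffL L (2 * τ) f s| ≤ B * |2 * τ| ^ θ → |diffL L τ f s| ≤ B * |τ| ^ θ := by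
    intro τ s hτ hs hs' h
    have h₁ := two_pow_mul_abs_diffL_le (fun x hx hx' => hK τ x hτ hx hx') hs hs'
    rw [abs_mul, abs_two, Real.mul_rpow zero_le_two (abs_nonneg _)] at h
    have h₂ : (2 : ℝ) ≤ 2 ^ L := le_self_pow₀ one_le_two (by omega)
    have h₃ : B * (2 ^ θ * |τ| ^ θ) ≤ 2 ^ L * (2 ^ θ / 2 * B * |τ| ^ θ) := by
      have := mul_le_mul_of_nonneg_right h₂
        (show 0 ≤ (2 : ℝ) ^ θ / 2 * B * |τ| ^ θ by positivity)
      linarith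
    have h₄ : L * K * |τ| ^ θ ≤ (1 - 2 ^ θ / 2) * B * |τ| ^ θ := by gcongr
    refine le_of_mul_le_mul_left ?_ (show (0 : ℝ) < 2 ^ L by positivity)
    have h₅ := mul_le_mul_of_nonneg_left h₄ (show (0 : ℝ) ≤ 2 ^ L by positivity)
    linarith
  have hscale : ∀ n : ℕ, ∀ τ s : ℝ, τ ≠ 0 → T ≤ 2 ^ n * (3 * L * |τ|) → s ∈ Icc 0 T →
      s + L * τ ∈ Icc 0 T → |diffL L τ f s| ≤ B * |τ| ^ θ := by
    intro n
    induction n with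
    | zero => exact fun τ s _ h => hlarge τ s (by simpa using h)
    | succ n ih =>
      intro τ s hτ hn hs hs'
      have hn₂ : ∀ σ : ℝ, |σ| = |τ| → T ≤ 2 ^ n * (3 * L * |2 * σ|) := by
        intro σ hσ
        rw [abs_mul, abs_two, hσ]
        rw [pow_succ] at hn
        linarith
      by_cases hT3 : T ≤ 3 * L * |τ|
      · exact hlarge τ s hT3 hs hs'
      push Not at hT3
      have hforward : ∀ σ x : ℝ, |σ| = |τ| → x ∈ Icc 0 T → x + (2 * L : ℝ) * σ ∈ Icc 0 T →
          |diffL L σ f x| ≤ B * |σ| ^ θ := by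
        intro σ x hσ hx hx'
        have hσ0 : σ ≠ 0 := abs_pos.mp (hσ ▸ abs_pos.mpr hτ)
        refine hdouble σ x hσ0 hx hx' (ih _ x (mul_ne_zero two_ne_zero hσ0) (hn₂ σ hσ) hx ?_)
        convert hx' using 1
        ring
      by_cases hfit : s + (2 * L : ℝ) * τ ∈ Icc 0 T
      · exact hforward τ s rfl hs hfit
      · have hback : s + L * τ + (2 * L : ℝ) * -τ ∈ Icc 0 T := by
          obtain ⟨h₁, h₂⟩ := hs
          obtain ⟨h₃, h₄⟩ := hs'
          rw [mem_Icc, not_and_or, not_le, not_le] at hfit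
          rcases le_total 0 τ with h | h
          · rw [abs_of_nonneg h] at hT3
            have := mul_nonneg hLpos.le h
            constructor <;> rcases hfit with hfit | hfit <;> linarith
          · rw [abs_of_nonpos h] at hT3
            have := mul_nonpos_of_nonneg_of_nonpos hLpos.le h
            constructor <;> rcases hfit with hfit | hfit <;> linarith
        have := hforward (-τ) (s + L * τ) (abs_neg τ) hs' hback
        rwa [diffL_neg, abs_mul, abs_pow, abs_neg, abs_one, one_pow, one_mul, abs_neg] at this
  obtain ⟨n, hn⟩ := pow_unbounded_of_one_lt (T / (3 * L * |τ|)) one_lt_two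
  have hτ' : 0 < |τ| := abs_pos.mpr hτ
  refine hscale n τ s hτ ?_ hs hs'
  rw [div_lt_iff₀ (by positivity)] at hn
  exact hn.le

/-- The Marchaud-type inequality in terms of real upper bounds. -/
theorem exists_abs_sub_le_of_abs_diffL_le {L : ℕ} (hL : 1 ≤ L) {θ : ℝ} (hθ0 : 0 < θ)
    (hθ1 : θ < 1) :
    ∃ C₂ : ℝ, 0 < C₂ ∧ ∀ T : ℝ, 0 < T → ∃ C₁ : ℝ, 0 < C₁ ∧ ∀ (f : ℝ → ℝ) (M K : ℝ),
      0 ≤ M → 0 ≤ K → (∀ t ∈ Icc 0 T, |f t| ≤ M) →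
      (∀ τ s : ℝ, τ ≠ 0 → s ∈ Icc 0 T → s + (L : ℝ) * τ ∈ Icc 0 T →
        |diffL L τ f s| ≤ K * |τ| ^ θ) →
      ∀ t ∈ Icc 0 T, ∀ s ∈ Icc 0 T, t ≠ s →
        |f t - f s| ≤ (C₁ * M + C₂ * K) * |t - s| ^ θ := by
  induction L, hL using Nat.le_induction with
  | base =>
    refine ⟨1, one_pos, fun T _ => ⟨1, one_pos, fun f M K hM0 _ _ hK t ht s hs hts => ?_⟩⟩
    have h := hK (t - s) s (sub_ne_zero.mpr hts) hs (by simpa using ht)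
    have hdiff : diffL 1 (t - s) f s = f t - f s := by
      simp [diffL_eq_fwdDiff_iter, fwdDiff]
    rw [hdiff] at h
    refine h.trans ?_
    gcongr
    linarith
  | succ L hL ih =>
    obtain ⟨C₂, hC₂, ih⟩ := ih
    have hLpos : (0 : ℝ) < L := by exact_mod_cast hL
    have hr := one_sub_two_rpow_div_two_pos hθ1
    refine ⟨C₂ * (L / (1 - 2 ^ θ / 2)), by positivity, fun T hT => ?_⟩
    obtain ⟨C₁, hC₁, ih⟩ := ih T hT
    refine ⟨C₁ + C₂ * (2 ^ L * (3 * L / T) ^ θ), by positivity,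
      fun f M K hM0 hK0 hM hK t ht s hs hts => ?_⟩
    have h := ih f M (2 ^ L * (3 * L / T) ^ θ * M + L / (1 - 2 ^ θ / 2) * K) hM0
      (by positivity) hM
      (fun τ s hτ hs hs' => abs_diffL_le_of_succ hL hθ0 hθ1 hT hM0 hK0 hM hK hτ hs hs')
      t ht s hs hts
    exact h.trans_eq (by ring)

theorem ofReal_abs_diffL_le_holderSemiL {T θ τ s : ℝ} {L : ℕ} {f : ℝ → ℝ} (hτ : τ ≠ 0)
    (hs : s ∈ Icc 0 T) (hs' : s + (L : ℝ) * τ ∈ Icc 0 T) :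
    ENNReal.ofReal |diffL L τ f s| ≤ holderSemiL T L θ f * ENNReal.ofReal (|τ| ^ θ) := by
  have hτ' : 0 < |τ| := abs_pos.mpr hτ
  have hpow : 0 < |τ| ^ θ := Real.rpow_pos_of_pos hτ' θ
  have h₁ : ENNReal.ofReal |diffL L τ f s| ≤ modulusL T L f |τ| :=
    le_iSup₂_of_le τ ⟨hτ', le_rfl⟩
      (le_iSup₂_of_le (f := fun s (_ : s ∈ Icc 0 T ∧ s + (L : ℝ) * τ ∈ Icc 0 T) =>
        ENNReal.ofReal |diffL L τ f s|) s ⟨hs, hs'⟩ le_rfl)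
  have h₂ : modulusL T L f |τ| / ENNReal.ofReal (|τ| ^ θ) ≤ holderSemiL T L θ f :=
    le_iSup₂_of_le |τ| hτ' le_rfl
  rw [ENNReal.div_le_iff (by simpa using hpow) ENNReal.ofReal_ne_top] at h₂
  exact h₁.trans h₂

/-- **Marchaud-type inequality.** -/
theorem marchaud_inequality (L : ℕ) (hL : 1 ≤ L) (θ : ℝ) (hθ0 : 0 < θ) (hθ1 : θ < 1) :
    ∃ N₂ : ℝ, ∀ T : ℝ, 0 < T → ∃ N₁ : ℝ,
      ∀ f : ℝ → ℝ, ContinuousOn f (Set.Icc 0 T) →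
        (⨆ (t : ℝ) (_ : t ∈ Set.Icc 0 T) (s : ℝ) (_ : s ∈ Set.Icc 0 T) (_ : t ≠ s),
            ENNReal.ofReal (|f t - f s| / |t - s| ^ θ)) ≤
          ENNReal.ofReal N₁ * (⨆ (t : ℝ) (_ : t ∈ Set.Icc 0 T), ENNReal.ofReal |f t|) +
            ENNReal.ofReal N₂ * holderSemiL T L θ f := by
  obtain ⟨C₂, hC₂, h⟩ := exists_abs_sub_le_of_abs_diffL_le hL hθ0 hθ1
  refine ⟨C₂, fun T hT => ?_⟩
  obtain ⟨C₁, hC₁, h⟩ := h T hT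
  refine ⟨C₁, fun f _ => ?_⟩
  set M := ⨆ (t : ℝ) (_ : t ∈ Set.Icc 0 T), ENNReal.ofReal |f t| with hM
  by_cases hMtop : M = ⊤
  · rw [hMtop, ENNReal.mul_top (by simpa using hC₁), top_add]
    exact le_top
  by_cases hKtop : holderSemiL T L θ f = ⊤
  · rw [hKtop, ENNReal.mul_top (by simpa using hC₂), add_top]
    exact le_top
  have hbound : ∀ t ∈ Icc 0 T, |f t| ≤ M.toReal := fun t ht =>
    (ENNReal.ofReal_le_iff_le_toReal hMtop).mp (le_iSup₂_of_le t ht le_rfl)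
  have hdiff : ∀ τ s : ℝ, τ ≠ 0 → s ∈ Icc 0 T → s + (L : ℝ) * τ ∈ Icc 0 T →
      |diffL L τ f s| ≤ (holderSemiL T L θ f).toReal * |τ| ^ θ := by
    intro τ s hτ hs hs'
    have := ofReal_abs_diffL_le_holderSemiL (θ := θ) (f := f) hτ hs hs'
    rw [ENNReal.ofReal_le_iff_le_toReal (ENNReal.mul_ne_top hKtop ENNReal.ofReal_ne_top),
      ENNReal.toReal_mul, ENNReal.toReal_ofReal (by positivity)] at this
    exact this
  refine iSup₂_le fun t ht => iSup₂_le fun s hs => iSup_le fun hts => ?_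
  have hpos : 0 < |t - s| ^ θ := Real.rpow_pos_of_pos (abs_pos.mpr (sub_ne_zero.mpr hts)) θ
  have hquot := h f M.toReal (holderSemiL T L θ f).toReal ENNReal.toReal_nonneg
    ENNReal.toReal_nonneg hbound hdiff t ht s hs hts
  rw [← div_le_iff₀ hpos] at hquot
  refine (ENNReal.ofReal_le_ofReal hquot).trans_eq ?_
  rw [ENNReal.ofReal_add (by positivity) (by positivity), ENNReal.ofReal_mul hC₁.le,
    ENNReal.ofReal_mul hC₂.le, ENNReal.ofReal_toReal hMtop, ENNReal.ofReal_toReal hKtop]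
end

section
/- Discrete Volterra-type sequence lemma: Let L ≥ 1 and J ≥ 2 be integers, let a₀ ≥ a₁ ≥ … ≥ a_J ≥ 0 be a nonincreasing sequence of nonnegative reals, and let b₁, …, b_J ≥ 0. Assume that for every k ∈ {0, 1, …, J−2}, a_k ≤ 2^{−L(J−1−k)} a_J + (2^L − 1) Σ_{j=k+1}^{J−1} 2^{−L(j−k)} a_j + L 2^{L−1} Σ_{j=k}^{J−1} 2^{−L(j−k)} b_{j+1}. Then there exists a constant N depending only on L such that a₀ ≤ N ( (1 + 2^{−LJ}) a_J + Σ_{j=1}^{J} (1 + 2^{−Lj}) b_j ). -/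
/-- Weighted sums with geometric weights `2 ^ (-L (j - k))` satisfy a first-order recursion in the
base point `k`. -/
theorem sum_Icc_two_zpow_mul (L k m n : ℕ) (f : ℕ → ℝ) :
    ∑ j ∈ Finset.Icc m n, (2 : ℝ) ^ (-(L * (j - k) : ℤ)) * f j =
      ((2 : ℝ) ^ L)⁻¹ *
        ∑ j ∈ Finset.Icc m n, (2 : ℝ) ^ (-(L * (j - (k + 1 : ℕ)) : ℤ)) * f j := by
  rw [Finset.mul_sum]
  refine Finset.sum_congr rfl fun j _ => ?_
  rw [← mul_assoc, ← zpow_natCast, ← zpow_neg, ← zpow_add₀ two_ne_zero]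
  congr 2
  push_cast
  ring

theorem sum_Icc_eq_add_sum_Icc_succ {m n : ℕ} (h : m ≤ n) (f : ℕ → ℝ) :
    ∑ j ∈ Finset.Icc m n, f j = f m + ∑ j ∈ Finset.Icc (m + 1) n, f j := by
  rw [← Finset.insert_Icc_add_one_left_eq_Icc h, Finset.sum_insert (by simp)]

/-- **Discrete Volterra-type sequence lemma.** -/
theorem discrete_volterra (L : ℕ) (hL : 1 ≤ L) :
    ∃ N : ℝ, ∀ J : ℕ, 2 ≤ J → ∀ a b : ℕ → ℝ,
      (∀ k, k < J → a (k + 1) ≤ a k) → 0 ≤ a J →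
      (∀ j, 1 ≤ j → j ≤ J → 0 ≤ b j) →
      (∀ k, k ≤ J - 2 →
        a k ≤ (2 : ℝ) ^ (-(L * (J - 1 - k) : ℤ)) * a J +
            ((2 : ℝ) ^ L - 1) *
              ∑ j ∈ Finset.Icc (k + 1) (J - 1), (2 : ℝ) ^ (-(L * (j - k) : ℤ)) * a j +
            (L : ℝ) * 2 ^ (L - 1) *
              ∑ j ∈ Finset.Icc k (J - 1), (2 : ℝ) ^ (-(L * (j - k) : ℤ)) * b (j + 1)) →
      a 0 ≤ N * ((1 + (2 : ℝ) ^ (-(L * J : ℤ))) * a J +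
        ∑ j ∈ Finset.Icc 1 J, (1 + (2 : ℝ) ^ (-(L * j : ℤ))) * b j) := by
  refine ⟨1 + 2 ^ L * (L * 2 ^ (L - 1)), fun J hJ a b ha haJ hb h => ?_⟩
  obtain ⟨n, rfl⟩ := Nat.exists_eq_add_of_le' hJ
  simp only [show n + 2 - 1 = n + 1 by omega, show n + 2 - 2 = n by omega] at h
  set Q : ℝ := 2 ^ L with hQ
  have hQ1 : 1 ≤ Q := one_le_pow₀ one_le_two
  have hQ0 : 0 < Q := by linarith
  set c : ℝ := L * 2 ^ (L - 1) with hc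
  have hc0 : 0 ≤ c := by positivity
  set T : ℕ → ℝ := fun k => (2 : ℝ) ^ (-(L * ((n + 2 : ℕ) - 1 - k) : ℤ)) * a (n + 2) +
    (Q - 1) * ∑ j ∈ Finset.Icc (k + 1) (n + 1), (2 : ℝ) ^ (-(L * (j - k) : ℤ)) * a j +
    c * ∑ j ∈ Finset.Icc k (n + 1), (2 : ℝ) ^ (-(L * (j - k) : ℤ)) * b (j + 1) with hT
  have hrec : ∀ k ≤ n, T k = c * b (k + 1) + Q⁻¹ * ((Q - 1) * a (k + 1) + T (k + 1)) := by
    intro k hk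
    have hpow : (2 : ℝ) ^ (-(L * ((n + 2 : ℕ) - 1 - k) : ℤ)) =
        Q⁻¹ * (2 : ℝ) ^ (-(L * ((n + 2 : ℕ) - 1 - (k + 1 : ℕ)) : ℤ)) := by
      rw [hQ, ← zpow_natCast, ← zpow_neg, ← zpow_add₀ two_ne_zero]
      congr 1
      push_cast
      ring
    simp only [hT]
    rw [hpow, sum_Icc_eq_add_sum_Icc_succ (show k ≤ n + 1 by omega),
      sum_Icc_two_zpow_mul L k (k + 1) (n + 1) a,
      sum_Icc_two_zpow_mul L k (k + 1) (n + 1) fun j => b (j + 1),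
      sum_Icc_eq_add_sum_Icc_succ (show k + 1 ≤ n + 1 by omega)
        fun j => (2 : ℝ) ^ (-(L * (j - (k + 1 : ℕ)) : ℤ)) * a j]
    simp only [sub_self, mul_zero, neg_zero, zpow_zero, one_mul]
    ring
  have hlast : T (n + 1) = a (n + 2) + c * b (n + 2) := by
    simp [hT, show ((n : ℤ) + 2 - 1 - (n + 1)) = 0 by ring]
  have hsum : ∀ k ≤ n, T 0 ≤ T k + c * ∑ j ∈ Finset.Icc 1 k, b j := by
    intro k
    induction k with
    | zero => simp
    | succ k ih =>
      intro hk
      have hstep : Q⁻¹ * ((Q - 1) * a (k + 1) + T (k + 1)) ≤ T (k + 1) := by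
        rw [inv_mul_le_iff₀ hQ0]
        nlinarith [h (k + 1) hk]
      rw [Finset.sum_Icc_succ_top (by omega)]
      linarith [ih (by omega), hrec k (by omega)]
  have hanti : a (n + 1) ≤ a 0 := by
    have : ∀ k ≤ n + 2, a k ≤ a 0 := by
      intro k
      induction k with
      | zero => simp
      | succ k ih => exact fun hk => (ha k hk).trans (ih (by omega))
    exact this _ (by omega)
  set B := ∑ j ∈ Finset.Icc 1 (n + 2), b j with hB
  have hBsplit : B = ∑ j ∈ Finset.Icc 1 n, b j + b (n + 1) + b (n + 2) := by
    rw [hB, Finset.sum_Icc_succ_top (by omega), Finset.sum_Icc_succ_top (by omega)]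
  have hB0 : 0 ≤ B := Finset.sum_nonneg fun j hj =>
    hb j (Finset.mem_Icc.1 hj).1 (Finset.mem_Icc.1 hj).2
  have hmain : a 0 ≤ a (n + 2) + Q * c * B := by
    have h0 : a 0 ≤ T 0 := h 0 (Nat.zero_le n)
    have h1 : a 0 ≤ c * (B - b (n + 2)) +
        Q⁻¹ * ((Q - 1) * a (n + 1) + (a (n + 2) + c * b (n + 2))) := by
      have := hrec n le_rfl
      rw [hlast] at this
      rw [hBsplit]
      linarith [hsum n le_rfl]
    have h2 : Q * a 0 ≤ Q * (c * (B - b (n + 2))) +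
        ((Q - 1) * a (n + 1) + (a (n + 2) + c * b (n + 2))) := by
      have := mul_le_mul_of_nonneg_left h1 hQ0.le
      rwa [mul_add, mul_inv_cancel_left₀ hQ0.ne'] at this
    have h3 : (Q - 1) * a (n + 1) ≤ (Q - 1) * a 0 :=
      mul_le_mul_of_nonneg_left hanti (by linarith)
    have h4 : 0 ≤ (Q - 1) * (c * b (n + 2)) :=
      mul_nonneg (by linarith) (mul_nonneg hc0 (hb _ (by omega) le_rfl))
    linarith
  have hB' : B ≤ ∑ j ∈ Finset.Icc 1 (n + 2), (1 + (2 : ℝ) ^ (-(L * j : ℤ))) * b j :=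
    Finset.sum_le_sum fun j hj => le_mul_of_one_le_left
      (hb j (Finset.mem_Icc.1 hj).1 (Finset.mem_Icc.1 hj).2)
      (le_add_of_nonneg_right (by positivity))
  have hA' : a (n + 2) ≤ (1 + (2 : ℝ) ^ (-(L * (n + 2 : ℕ) : ℤ))) * a (n + 2) :=
    le_mul_of_one_le_left haJ (le_add_of_nonneg_right (by positivity))
  have hQc : 0 ≤ Q * c := mul_nonneg hQ0.le hc0
  calc a 0 ≤ a (n + 2) + Q * c * B := hmain
    _ ≤ (1 + Q * c) * (a (n + 2) + B) := by
      linarith [mul_nonneg hQc haJ]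
    _ ≤ _ := mul_le_mul_of_nonneg_left (add_le_add hA' hB') (by linarith)
end

section
/- Iterated Picard-type bound: Let T > 0, θ ≥ 0, N ≥ 0, and let (g_m)_{m ≥ 0} be a sequence of Lebesgue-measurable functions g_m : [0,T] → [0,∞] such that for every m ≥ 0 and every t ∈ [0,T], g_{m+1}(t) ≤ θ g_m(t) + N ∫_0^t g_m(s) ds. Then for every m ≥ 1 and every t ∈ [0,T], g_m(t) ≤ θ^m g₀(t) + Σ_{k=1}^{m} (m choose k) θ^{m−k} N^k ∫_0^t ((t−s)^{k−1} / (k−1)!) g₀(s) ds. -/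
open MeasureTheory Set
open scoped ENNReal

/-- The `k`-fold iterated integral of `f` from `0`, given by Cauchy's formula for `k ≥ 1`. -/
noncomputable def cauchyIntegral (f : ℝ → ℝ≥0∞) : ℕ → ℝ → ℝ≥0∞
  | 0, t => f t
  | k + 1, t => ∫⁻ s in Icc 0 t, ENNReal.ofReal ((t - s) ^ k / (k.factorial : ℝ)) * f s

theorem monotone_cauchyIntegral_succ (f : ℝ → ℝ≥0∞) (k : ℕ) :
    Monotone (cauchyIntegral f (k + 1)) := by
  intro a b hab
  refine (setLIntegral_mono' measurableSet_Icc fun s hs ↦ ?_).trans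
    (lintegral_mono_set (Icc_subset_Icc_right hab))
  have : 0 ≤ a - s := sub_nonneg.2 hs.2
  gcongr

theorem aemeasurable_cauchyIntegral {f : ℝ → ℝ≥0∞} {μ : Measure ℝ} (hf : AEMeasurable f μ)
    (k : ℕ) : AEMeasurable (cauchyIntegral f k) μ := by
  cases k with
  | zero => exact hf
  | succ k => exact (monotone_cauchyIntegral_succ f k).measurable.aemeasurable

theorem setLIntegral_Icc_sub_pow_div_factorial {r t : ℝ} (h : r ≤ t) (k : ℕ) :
    ∫⁻ s in Icc r t, ENNReal.ofReal ((s - r) ^ k / (k.factorial : ℝ)) =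
      ENNReal.ofReal ((t - r) ^ (k + 1) / ((k + 1).factorial : ℝ)) := by
  rw [← ofReal_integral_eq_lintegral_ofReal]
  · rw [integral_Icc_eq_integral_Ioc, ← intervalIntegral.integral_of_le h,
      intervalIntegral.integral_div,
      intervalIntegral.integral_comp_sub_right (fun x : ℝ ↦ x ^ k), integral_pow, sub_self,
      Nat.factorial_succ]
    push_cast
    congr 1
    field_simp
    simp
  · exact (by fun_prop : Continuous fun s : ℝ ↦ (s - r) ^ k / (k.factorial : ℝ)).integrableOn_Icc
  · filter_upwards [ae_restrict_mem measurableSet_Icc] with s hs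
    have : 0 ≤ s - r := sub_nonneg.2 hs.1
    simp only [Pi.zero_apply]
    positivity

theorem setLIntegral_cauchyIntegral {f : ℝ → ℝ≥0∞} {t : ℝ}
    (hf : AEMeasurable f (volume.restrict (Icc 0 t))) (k : ℕ) :
    ∫⁻ s in Icc 0 t, cauchyIntegral f k s = cauchyIntegral f (k + 1) t := by
  cases k with
  | zero => simp [cauchyIntegral]
  | succ k =>
    set F : ℝ → ℝ → ℝ≥0∞ := fun s r ↦
      {p : ℝ × ℝ | p.2 ≤ p.1}.indicator
        (fun p ↦ ENNReal.ofReal ((p.1 - p.2) ^ k / (k.factorial : ℝ))) (s, r) * f r with hF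
    have hmeas : AEMeasurable (Function.uncurry F)
        ((volume.restrict (Icc 0 t)).prod (volume.restrict (Icc 0 t))) := by
      refine AEMeasurable.mul (Measurable.aemeasurable ?_) hf.comp_snd
      exact Measurable.indicator (by fun_prop) (measurableSet_le measurable_snd measurable_fst)
    calc ∫⁻ s in Icc 0 t, cauchyIntegral f (k + 1) s
        = ∫⁻ s in Icc 0 t, ∫⁻ r in Icc 0 t, F s r := by
          refine setLIntegral_congr_fun measurableSet_Icc fun s hs ↦ ?_
          have hset : Icc 0 s = Iic s ∩ Icc 0 t := by
            ext r
            simp only [mem_Icc, mem_inter_iff, mem_Iic]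
            exact ⟨fun h ↦ ⟨h.2, h.1, h.2.trans hs.2⟩, fun h ↦ ⟨h.2.1, h.1⟩⟩
          simp only [cauchyIntegral]
          rw [hset, ← Measure.restrict_restrict measurableSet_Iic,
            ← lintegral_indicator measurableSet_Iic]
          refine lintegral_congr fun r ↦ ?_
          by_cases h : r ≤ s <;> simp [hF, indicator, h]
      _ = ∫⁻ r in Icc 0 t, ∫⁻ s in Icc 0 t, F s r := lintegral_lintegral_swap hmeas
      _ = cauchyIntegral f (k + 1 + 1) t := by
          refine setLIntegral_congr_fun measurableSet_Icc fun r hr ↦ ?_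
          have hset : Icc r t = Ici r ∩ Icc 0 t := by
            ext s
            simp only [mem_Icc, mem_inter_iff, mem_Ici]
            exact ⟨fun h ↦ ⟨h.1, hr.1.trans h.1, h.2⟩, fun h ↦ ⟨h.1, h.2.2⟩⟩
          simp only [hF]
          rw [lintegral_mul_const, ← setLIntegral_Icc_sub_pow_div_factorial hr.2, hset,
            ← Measure.restrict_restrict measurableSet_Ici,
            ← lintegral_indicator measurableSet_Ici]
          · congr 1
          · exact (Measurable.indicator (by fun_prop)
              (measurableSet_le measurable_snd measurable_fst)).comp measurable_prodMk_right

theorem le_sum_antidiagonal_cauchyIntegral {T : ℝ} {a b : ℝ≥0∞} {g : ℕ → ℝ → ℝ≥0∞}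
    (hmeas : AEMeasurable (g 0) (volume.restrict (Icc 0 T)))
    (hrec : ∀ m, ∀ t ∈ Icc (0 : ℝ) T, g (m + 1) t ≤ a * g m t + b * ∫⁻ s in Icc 0 t, g m s)
    (m : ℕ) {t : ℝ} (ht : t ∈ Icc (0 : ℝ) T) :
    g m t ≤ ∑ p ∈ Finset.HasAntidiagonal.antidiagonal m,
      (m.choose p.1 : ℝ≥0∞) * (a ^ p.2 * b ^ p.1 * cauchyIntegral (g 0) p.1 t) := by
  induction m generalizing t with
  | zero => simp [cauchyIntegral]
  | succ m ih =>
    have hsub : Icc 0 t ⊆ Icc 0 T := Icc_subset_Icc_right ht.2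
    have hf := hmeas.mono_measure (Measure.restrict_mono_set volume hsub)
    have hint : ∫⁻ s in Icc 0 t, g m s ≤ ∑ p ∈ Finset.HasAntidiagonal.antidiagonal m,
        (m.choose p.1 : ℝ≥0∞) * (a ^ p.2 * b ^ p.1 * cauchyIntegral (g 0) (p.1 + 1) t) := by
      refine (setLIntegral_mono' measurableSet_Icc fun s hs ↦ ih (hsub hs)).trans_eq ?_
      rw [lintegral_finsetSum' _ fun p _ ↦
        ((aemeasurable_cauchyIntegral hf p.1).const_mul _).const_mul _]
      refine Finset.sum_congr rfl fun p _ ↦ ?_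
      have hp := aemeasurable_cauchyIntegral hf p.1
      rw [lintegral_const_mul'' _ (hp.const_mul _), lintegral_const_mul'' _ hp,
        setLIntegral_cauchyIntegral hf]
    refine (hrec m t ht).trans ((add_le_add (mul_le_mul_right (ih ht) a)
      (mul_le_mul_right hint b)).trans_eq ?_)
    rw [Finset.sum_antidiagonal_choose_succ_mul
      (fun i j ↦ a ^ j * b ^ i * cauchyIntegral (g 0) i t), Finset.mul_sum, Finset.mul_sum]
    congr 1
    · exact Finset.sum_congr rfl fun p _ ↦ by ring
    · refine Finset.sum_congr rfl fun p hp ↦ ?_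
      rw [Nat.choose_symm_of_eq_add (Finset.HasAntidiagonal.mem_antidiagonal.1 hp).symm]
      ring

open MeasureTheory Set
open scoped ENNReal

/-- **Iterated Picard-type bound.** -/
theorem iterated_picard_bound (T : ℝ) (hT : 0 < T) (θ N : ℝ) (hθ : 0 ≤ θ) (hN : 0 ≤ N)
    (g : ℕ → ℝ → ℝ≥0∞)
    (hmeas : ∀ m, AEMeasurable (g m) (volume.restrict (Set.Icc 0 T)))
    (hrec : ∀ m, ∀ t ∈ Set.Icc (0 : ℝ) T,
      g (m + 1) t ≤ ENNReal.ofReal θ * g m t + ENNReal.ofReal N * ∫⁻ s in Set.Icc 0 t, g m s) :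
    ∀ m, 1 ≤ m → ∀ t ∈ Set.Icc (0 : ℝ) T,
      g m t ≤ ENNReal.ofReal θ ^ m * g 0 t +
        ∑ k ∈ Finset.Icc 1 m, (m.choose k : ℝ≥0∞) * ENNReal.ofReal θ ^ (m - k) *
          ENNReal.ofReal N ^ k *
          ∫⁻ s in Set.Icc 0 t,
            ENNReal.ofReal ((t - s) ^ (k - 1) / ((k - 1).factorial : ℝ)) * g 0 s := by
  intro m _ t ht
  refine (le_sum_antidiagonal_cauchyIntegral (hmeas 0) hrec m ht).trans_eq ?_
  rw [Finset.Nat.sum_antidiagonal_eq_sum_range_succ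
    (fun i j ↦ (m.choose i : ℝ≥0∞) * (ENNReal.ofReal θ ^ j * ENNReal.ofReal N ^ i *
      cauchyIntegral (g 0) i t)), Finset.sum_range_succ', add_comm, Finset.range_eq_Ico,
    Finset.sum_Ico_add' (fun i ↦ (m.choose i : ℝ≥0∞) * (ENNReal.ofReal θ ^ (m - i) *
      ENNReal.ofReal N ^ i * cauchyIntegral (g 0) i t)), zero_add]
  congr 1
  · simp [cauchyIntegral]
  · refine Finset.sum_congr (by ext; simp) fun k hk ↦ ?_
    obtain ⟨k, rfl⟩ : ∃ j, k = j + 1 := ⟨k - 1, by simp at hk; omega⟩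
    simp only [cauchyIntegral, Nat.add_sub_cancel]
    ring
end

section
/- Convolution estimate with L¹–L_r interpolation: Let d ≥ 1, p ∈ [1,∞), r ∈ [1,p], and λ ≥ 0, and let K, u : ℝ^d → [0,∞] be measurable. Then ( ∫_{ℝ^d} ( ∫_{ℝ^d} K(x−y) u(y)^{1+λ} dy )^p dx )^{1/p} ≤ ( ∫_{ℝ^d} K(y)^r dy )^{1/r} · ( ∫_{ℝ^d} u(y) dy )^{1 − 1/r} · ( ∫_{ℝ^d} u(y)^{p/r + pλ} dy )^{1/p}, where all integrals are Lebesgue integrals valued in [0,∞] and the inequality is understood in [0,∞]. -/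
open MeasureTheory Set
open scoped ENNReal

/-- Hölder's inequality for three nonnegative functions, with weights summing to one. -/
lemma lintegral_mul_mul_rpow_le {α : Type*} [MeasurableSpace α] {μ : Measure α}
    {f g h : α → ℝ≥0∞} (hf : AEMeasurable f μ) (hg : AEMeasurable g μ) (hh : AEMeasurable h μ)
    {a b c : ℝ} (ha : 0 ≤ a) (hb : 0 ≤ b) (hc : 0 ≤ c) (habc : a + b + c = 1) :
    ∫⁻ x, f x ^ a * g x ^ b * h x ^ c ∂μ ≤
      (∫⁻ x, f x ∂μ) ^ a * (∫⁻ x, g x ∂μ) ^ b * (∫⁻ x, h x ∂μ) ^ c := by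
  have key := ENNReal.lintegral_prod_norm_pow_le (μ := μ) Finset.univ (f := ![f, g, h])
    (p := ![a, b, c]) (by simp [Fin.forall_fin_succ, hf, hg, hh])
    (by simpa [Fin.sum_univ_three] using habc) (by simp [Fin.forall_fin_succ, ha, hb, hc])
  simpa [Fin.prod_univ_three] using key

/-- The integral of a convolution is the product of the integrals. -/
lemma lintegral_lintegral_sub_mul {G : Type*} [AddCommGroup G] [MeasurableSpace G]
    [MeasurableAdd₂ G] [MeasurableNeg G] {μ : Measure G} [SFinite μ] [μ.IsAddLeftInvariant]
    {f g : G → ℝ≥0∞} (hf : Measurable f) (hg : Measurable g) :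
    ∫⁻ x, ∫⁻ y, f (x - y) * g y ∂μ ∂μ = (∫⁻ x, f x ∂μ) * ∫⁻ y, g y ∂μ := by
  rw [lintegral_lintegral_swap (by fun_prop), ← lintegral_const_mul _ hg]
  refine lintegral_congr fun y => ?_
  rw [lintegral_mul_const _ (by fun_prop), lintegral_sub_right_eq_self f y]

/-- **Convolution estimate with `L¹`–`L_r` interpolation.** -/
theorem convolution_L1_Lr_interpolation (d : ℕ) (hd : 1 ≤ d)
    (p r lam : ℝ) (hp : 1 ≤ p) (hr : 1 ≤ r) (hrp : r ≤ p) (hlam : 0 ≤ lam)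
    (K u : EuclideanSpace ℝ (Fin d) → ℝ≥0∞) (hK : Measurable K) (hu : Measurable u) :
    (∫⁻ x, (∫⁻ y, K (x - y) * u y ^ (1 + lam)) ^ p) ^ (1 / p) ≤
      (∫⁻ y, K y ^ r) ^ (1 / r) * (∫⁻ y, u y) ^ (1 - 1 / r) *
        (∫⁻ y, u y ^ (p / r + p * lam)) ^ (1 / p) := by
  have hp0 : 0 < p := by linarith
  have hr0 : 0 < r := by linarith
  have hpinv : 0 ≤ 1 / p := by positivity
  have hb : 0 ≤ 1 / r - 1 / p := sub_nonneg.2 (one_div_le_one_div_of_le hr0 hrp)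
  have hc : 0 ≤ 1 - 1 / r := sub_nonneg.2 ((div_le_one hr0).2 hr)
  set w : EuclideanSpace ℝ (Fin d) → ℝ≥0∞ := fun y => u y ^ (p / r + p * lam) with hw_def
  have hw : Measurable w := hu.pow_const _
  have hKr : Measurable fun y => K y ^ r := hK.pow_const _
  set A := ∫⁻ y, K y ^ r with hA
  set U := ∫⁻ y, u y with hU
  have split (x y : EuclideanSpace ℝ (Fin d)) : K (x - y) * u y ^ (1 + lam) =
      (K (x - y) ^ r * w y) ^ (1 / p) * (K (x - y) ^ r) ^ (1 / r - 1 / p) *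
        u y ^ (1 - 1 / r) := by
    have eK : K (x - y) = (K (x - y) ^ r) ^ (1 / p) * (K (x - y) ^ r) ^ (1 / r - 1 / p) := by
      rw [← ENNReal.rpow_add_of_nonneg _ _ hpinv hb, ← ENNReal.rpow_mul]
      rw [show r * (1 / p + (1 / r - 1 / p)) = 1 by field_simp; ring, ENNReal.rpow_one]
    have eu : u y ^ (1 + lam) = w y ^ (1 / p) * u y ^ (1 - 1 / r) := by
      rw [hw_def, ← ENNReal.rpow_mul, ← ENNReal.rpow_add_of_nonneg _ _ (by positivity) hc]
      congr 1
      field_simp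
      ring
    rw [ENNReal.mul_rpow_of_nonneg _ _ hpinv, eu]
    nth_rewrite 1 [eK]
    ring
  have inner_le (x : EuclideanSpace ℝ (Fin d)) : ∫⁻ y, K (x - y) * u y ^ (1 + lam) ≤
      (∫⁻ y, K (x - y) ^ r * w y) ^ (1 / p) * (A ^ (1 / r - 1 / p) * U ^ (1 - 1 / r)) := by
    simp_rw [split x]
    refine (lintegral_mul_mul_rpow_le (by fun_prop) (by fun_prop) (by fun_prop)
      hpinv hb hc (by ring)).trans_eq ?_
    rw [lintegral_sub_left_eq_self (fun y => K y ^ r) x, mul_assoc]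
  have hconv : Measurable fun x => ∫⁻ y, K (x - y) ^ r * w y :=
    Measurable.lintegral_prod_right' (f := fun z : _ × _ => K (z.1 - z.2) ^ r * w z.2)
      (by fun_prop)
  calc (∫⁻ x, (∫⁻ y, K (x - y) * u y ^ (1 + lam)) ^ p) ^ (1 / p)
      ≤ (∫⁻ x, ((∫⁻ y, K (x - y) ^ r * w y) ^ (1 / p) *
          (A ^ (1 / r - 1 / p) * U ^ (1 - 1 / r))) ^ p) ^ (1 / p) := by
        gcongr with x
        exact inner_le x
    _ = (A * (∫⁻ y, w y) * (A ^ (1 / r - 1 / p) * U ^ (1 - 1 / r)) ^ p) ^ (1 / p) := by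
        simp_rw [ENNReal.mul_rpow_of_nonneg _ (A ^ (1 / r - 1 / p) * U ^ (1 - 1 / r)) hp0.le,
          ← ENNReal.rpow_mul, one_div_mul_cancel hp0.ne', ENNReal.rpow_one]
        rw [lintegral_mul_const _ hconv, lintegral_lintegral_sub_mul hKr hw]
    _ = A ^ (1 / p) * A ^ (1 / r - 1 / p) * U ^ (1 - 1 / r) * (∫⁻ y, w y) ^ (1 / p) := by
        rw [ENNReal.mul_rpow_of_nonneg _ _ hpinv, ENNReal.mul_rpow_of_nonneg _ _ hpinv,
          ← ENNReal.rpow_mul _ p, mul_one_div_cancel hp0.ne', ENNReal.rpow_one]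
        ring
    _ = A ^ (1 / r) * U ^ (1 - 1 / r) * (∫⁻ y, w y) ^ (1 / p) := by
        rw [← ENNReal.rpow_add_of_nonneg _ _ hpinv hb, add_sub_cancel]
end

section
/- Derivative bounds for Bernstein functions: Let φ : (0,∞) → [0,∞) be a Bernstein function. Then for every integer n ≥ 1 there exists a constant N = N(n), depending only on n, such that for all λ > 0, λ^n · |φ^{(n)}(λ)| ≤ N · φ(λ). -/
open Set

/-- A Bernstein function: infinitely differentiable on `(0,∞)`, nonnegative, with
`(-1)^n φ^{(n)} ≤ 0` on `(0,∞)` for all `n ≥ 1`. -/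
def IsBernstein (φ : ℝ → ℝ) : Prop :=
  (∀ x : ℝ, 0 < x → 0 ≤ φ x) ∧ ContDiffOn ℝ (⊤ : ℕ∞) φ (Ioi 0) ∧
    ∀ n : ℕ, 1 ≤ n → ∀ x : ℝ, 0 < x →
      (-1 : ℝ) ^ n * iteratedDerivWithin n φ (Ioi 0) x ≤ 0

theorem IsBernstein.hasDerivAt_iteratedDerivWithin {φ : ℝ → ℝ} (h : IsBernstein φ) (n : ℕ)
    {x : ℝ} (hx : 0 < x) :
    HasDerivAt (iteratedDerivWithin n φ (Ioi 0)) (iteratedDerivWithin (n + 1) φ (Ioi 0) x) x := by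
  have hd : DifferentiableWithinAt ℝ (iteratedDerivWithin n φ (Ioi 0)) (Ioi 0) x :=
    h.2.1.differentiableOn_iteratedDerivWithin (by exact_mod_cast WithTop.coe_lt_top n)
      isOpen_Ioi.uniqueDiffOn x hx
  rw [iteratedDerivWithin_succ]
  exact hd.hasDerivWithinAt.hasDerivAt (Ioi_mem_nhds hx)

/-- If `f'` is nonnegative on `(0,∞)`, then `f` is nondecreasing there. -/
theorem monotoneOn_Ioi_of_hasDerivAt_nonneg {f f' : ℝ → ℝ}
    (hf : ∀ x, 0 < x → HasDerivAt f (f' x) x) (hf' : ∀ x, 0 < x → 0 ≤ f' x) :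
    MonotoneOn f (Ioi 0) := by
  refine monotoneOn_of_deriv_nonneg (convex_Ioi 0)
    (fun x hx => (hf x hx).continuousAt.continuousWithinAt) ?_ ?_
  · intro x hx
    rw [interior_Ioi] at hx
    exact (hf x hx).differentiableAt.differentiableWithinAt
  · intro x hx
    rw [interior_Ioi] at hx
    rw [(hf x hx).deriv]
    exact hf' x hx

theorem IsBernstein.monotoneOn {φ : ℝ → ℝ} (h : IsBernstein φ) : MonotoneOn φ (Ioi 0) := by
  refine monotoneOn_Ioi_of_hasDerivAt_nonneg (f' := iteratedDerivWithin 1 φ (Ioi 0)) ?_ ?_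
  · intro x hx
    simpa using h.hasDerivAt_iteratedDerivWithin 0 hx
  · intro x hx
    simpa using h.2.2 1 le_rfl x hx

theorem IsBernstein.abs_iteratedDerivWithin_antitoneOn {φ : ℝ → ℝ} (h : IsBernstein φ) {n : ℕ}
    (hn : 1 ≤ n) : AntitoneOn (fun x => |iteratedDerivWithin n φ (Ioi 0) x|) (Ioi 0) := by
  have hmono : MonotoneOn (fun x => (-1 : ℝ) ^ n * iteratedDerivWithin n φ (Ioi 0) x) (Ioi 0) := by
    refine monotoneOn_Ioi_of_hasDerivAt_nonneg
      (fun x hx => (h.hasDerivAt_iteratedDerivWithin n hx).const_mul _) fun x hx => ?_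
    have := h.2.2 (n + 1) (by omega) x hx
    rw [pow_succ] at this
    linarith
  have habs : ∀ x, 0 < x → |iteratedDerivWithin n φ (Ioi 0) x| =
      -((-1 : ℝ) ^ n * iteratedDerivWithin n φ (Ioi 0) x) := by
    intro x hx
    rw [← abs_of_nonpos (h.2.2 n hn x hx), abs_mul, abs_pow, abs_neg, abs_one, one_pow, one_mul]
  intro x hx y hy hxy
  simp only [habs x hx, habs y hy]
  exact neg_le_neg (hmono hx hy hxy)

/-- The mean value theorem on `[x/2, x]` bounds the next derivative by the previous one. -/
theorem IsBernstein.mul_abs_iteratedDerivWithin_succ_le {φ : ℝ → ℝ} (h : IsBernstein φ) (n : ℕ)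
    {x : ℝ} (hx : 0 < x) :
    x * |iteratedDerivWithin (n + 1) φ (Ioi 0) x| ≤
      2 * (|iteratedDerivWithin n φ (Ioi 0) x| + |iteratedDerivWithin n φ (Ioi 0) (x / 2)|) := by
  obtain ⟨c, hc, hceq⟩ := exists_hasDerivAt_eq_slope (iteratedDerivWithin n φ (Ioi 0))
    (iteratedDerivWithin (n + 1) φ (Ioi 0)) (half_lt_self hx)
    (fun y hy => (h.hasDerivAt_iteratedDerivWithin n
      ((half_pos hx).trans_le hy.1)).continuousAt.continuousWithinAt)
    (fun y hy => h.hasDerivAt_iteratedDerivWithin n ((half_pos hx).trans hy.1))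
  have hanti : |iteratedDerivWithin (n + 1) φ (Ioi 0) x| ≤
      |iteratedDerivWithin (n + 1) φ (Ioi 0) c| :=
    h.abs_iteratedDerivWithin_antitoneOn n.succ_pos ((half_pos hx).trans hc.1) hx hc.2.le
  rw [hceq, sub_half, abs_div, abs_of_pos (half_pos hx), le_div_iff₀ (half_pos hx)] at hanti
  have := abs_sub (iteratedDerivWithin n φ (Ioi 0) x) (iteratedDerivWithin n φ (Ioi 0) (x / 2))
  linarith

theorem IsBernstein.exists_pow_mul_abs_iteratedDerivWithin_le (n : ℕ) :
    ∃ N : ℝ, 0 ≤ N ∧ ∀ φ : ℝ → ℝ, IsBernstein φ → ∀ x : ℝ, 0 < x →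
      x ^ n * |iteratedDerivWithin n φ (Ioi 0) x| ≤ N * φ x := by
  induction n with
  | zero =>
    refine ⟨1, zero_le_one, fun φ h x hx => ?_⟩
    simp [abs_of_nonneg (h.1 x hx)]
  | succ n ih =>
    obtain ⟨N, hN, hbound⟩ := ih
    refine ⟨2 * (1 + 2 ^ n) * N, by positivity, fun φ h x hx => ?_⟩
    have hhalf : N * φ (x / 2) ≤ N * φ x :=
      mul_le_mul_of_nonneg_left
        (h.monotoneOn (half_pos hx) hx (half_le_self hx.le)) hN
    calc x ^ (n + 1) * |iteratedDerivWithin (n + 1) φ (Ioi 0) x|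
        = x ^ n * (x * |iteratedDerivWithin (n + 1) φ (Ioi 0) x|) := by ring
      _ ≤ x ^ n * (2 * (|iteratedDerivWithin n φ (Ioi 0) x| +
            |iteratedDerivWithin n φ (Ioi 0) (x / 2)|)) := by
          exact mul_le_mul_of_nonneg_left (h.mul_abs_iteratedDerivWithin_succ_le n hx) (by positivity)
      _ = 2 * (x ^ n * |iteratedDerivWithin n φ (Ioi 0) x| +
            2 ^ n * ((x / 2) ^ n * |iteratedDerivWithin n φ (Ioi 0) (x / 2)|)) := by
          rw [div_pow]
          field_simp
      _ ≤ 2 * (N * φ x + 2 ^ n * (N * φ x)) := by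
          have hx2 := (hbound φ h _ (half_pos hx)).trans hhalf
          linarith [hbound φ h x hx, mul_le_mul_of_nonneg_left hx2 (by positivity : (0 : ℝ) ≤ 2 ^ n)]
      _ = 2 * (1 + 2 ^ n) * N * φ x := by ring

/-- **Derivative bounds for Bernstein functions.** -/
theorem bernstein_derivative_bound (n : ℕ) (hn : 1 ≤ n) :
    ∃ N : ℝ, ∀ φ : ℝ → ℝ, IsBernstein φ → ∀ x : ℝ, 0 < x →
      x ^ n * |iteratedDerivWithin n φ (Ioi 0) x| ≤ N * φ x := by
  obtain ⟨N, -, hN⟩ := IsBernstein.exists_pow_mul_abs_iteratedDerivWithin_le n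
  exact ⟨N, hN⟩
end
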